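/- Let p be an odd prime, q = p^n, and r ≥ 1 an integer such that GL_2(F_q) contains an element of order 2^r. If q ≡ 1 (mod 2^r), then K_{2^r}(GL_2(F_q)) = ℚ(ζ_{2^r}); if q ≡ −1 (mod 2^r), then K_{2^r}(GL_2(F_q)) = ℚ(ζ_{2^r} + ζ_{2^r}^{−1}). -/

import Mathlib

open CategoryTheory

/-- `zeta N` is the root of unity `e^{2 π i / N}`. -/
noncomputable def zeta (N : ℕ) : ℂ := Complex.exp (2 * Real.pi * Complex.I / N)

/-- `charField G` is the field `K(G)` generated over `ℚ` by all values of
irreducible complex characters of `G`. -/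
noncomputable def charField (G : Type) [Group G] : IntermediateField ℚ ℂ :=
  IntermediateField.adjoin ℚ
    {x : ℂ | ∃ V : FDRep ℂ G, Simple V ∧ ∃ g : G, V.character g = x}

/-- `charFieldAt G d` is the field `K_d(G)` generated over `ℚ` by the values of
irreducible complex characters of `G` at elements of order exactly `d`. -/
noncomputable def charFieldAt (G : Type) [Group G] (d : ℕ) : IntermediateField ℚ ℂ :=
  IntermediateField.adjoin ℚ
    {x : ℂ | ∃ V : FDRep ℂ G, Simple V ∧ ∃ g : G, orderOf g = d ∧ V.character g = x}

theorem FDRep.simple_of_isIrreducible {G V : Type} [Group G] [Finite G] [AddCommGroup V]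
    [Module ℂ V] [FiniteDimensional ℂ V] (ρ : Representation ℂ G V) [ρ.IsIrreducible] :
    Simple (FDRep.of ρ) := by
  classical
  have := Fintype.ofFinite G
  rw [FDRep.simple_iff_char_is_norm_one]
  have h := Representation.char_orthonormal ρ ρ
  rw [if_pos ⟨Representation.Equiv.refl ρ⟩] at h
  exact (inv_mul_eq_one₀ (NeZero.ne (Nat.card G : ℂ))).mp h |>.symm

theorem LinearMap.trace_eq_add_of_isCompl {V : Type*} [AddCommGroup V] [Module ℂ V]
    [FiniteDimensional ℂ V] {p q : Submodule ℂ V} (h : IsCompl p q) (f : V →ₗ[ℂ] V)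
    (hp : ∀ x ∈ p, f x ∈ p) (hq : ∀ x ∈ q, f x ∈ q) :
    LinearMap.trace ℂ V f =
      LinearMap.trace ℂ p (f.restrict hp) + LinearMap.trace ℂ q (f.restrict hq) := by
  have hint : DirectSum.IsInternal (fun b : Bool => cond b p q) :=
    (DirectSum.isInternal_submodule_iff_isCompl (fun b : Bool => cond b p q)
      (i := true) (j := false) (by simp) (by ext b; cases b <;> simp)).mpr h
  rw [LinearMap.trace_eq_sum_trace_restrict hint (f := f) (by rintro (_ | _) <;> assumption),
    Fintype.sum_bool]
  rfl

theorem trace_mem_charFieldAt {G : Type} [Group G] [Finite G] (g : G) {V : Type}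
    [AddCommGroup V] [Module ℂ V] [FiniteDimensional ℂ V] (ρ : Representation ℂ G V) :
    LinearMap.trace ℂ V (ρ g) ∈ charFieldAt G (orderOf g) := by
  induction hd : Module.finrank ℂ V using Nat.strong_induction_on generalizing V with
  | _ d ih =>
  by_cases hirr : ρ.IsIrreducible
  · exact IntermediateField.subset_adjoin _ _
      ⟨FDRep.of ρ, FDRep.simple_of_isIrreducible ρ, g, rfl, rfl⟩
  rcases subsingleton_or_nontrivial V with hV | hV
  · rw [show ρ g = 0 from Subsingleton.elim _ _, map_zero]
    exact zero_mem _
  have hnt : Nontrivial (Subrepresentation ρ) := ⟨⊥, ⊤, fun h => by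
    have : (⊥ : Submodule ℂ V) = ⊤ := congrArg Subrepresentation.toSubmodule h
    exact bot_ne_top this⟩
  obtain ⟨σ, hσb, hσt⟩ : ∃ σ : Subrepresentation ρ, σ ≠ ⊥ ∧ σ ≠ ⊤ := by
    by_contra! h
    exact hirr { eq_bot_or_eq_top := fun a => or_iff_not_imp_left.mpr (h a) }
  have hss : ρ.IsSemisimpleRepresentation := by
    rw [Representation.isSemisimpleRepresentation_iff_isSemisimpleModule_asModule]
    infer_instance
  obtain ⟨τ, hτ⟩ := exists_isCompl σ
  have hcompl : IsCompl σ.toSubmodule τ.toSubmodule := by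
    constructor
    · rw [disjoint_iff]
      exact congrArg Subrepresentation.toSubmodule hτ.inf_eq_bot
    · rw [codisjoint_iff]
      exact congrArg Subrepresentation.toSubmodule hτ.sup_eq_top
  have hlt (υ : Subrepresentation ρ) (h : υ ≠ ⊤) :
      Module.finrank ℂ υ.toSubmodule < d := by
    rw [← hd]
    exact Submodule.finrank_lt fun h' => h (Subrepresentation.toSubmodule_injective h')
  have hτt : τ ≠ ⊤ := by
    rintro rfl
    exact hσb (by simpa using hτ.inf_eq_bot)
  rw [LinearMap.trace_eq_add_of_isCompl hcompl (ρ g) (σ.apply_mem_toSubmodule g)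
    (τ.apply_mem_toSubmodule g)]
  exact add_mem (ih _ (hlt σ hσt) σ.toRepresentation rfl) (ih _ (hlt τ hτt) τ.toRepresentation rfl)

/-- The fixed space of an operator of finite order commuting with a representation is a
subrepresentation, and its character is the trace against the averaging projection. -/
theorem sum_trace_mul_pow_mem_charFieldAt {G : Type} [Group G] [Finite G] (g : G) {V : Type}
    [AddCommGroup V] [Module ℂ V] [FiniteDimensional ℂ V] (ρ : Representation ℂ G V)
    (A : Module.End ℂ V) (hA : ∀ h, Commute A (ρ h)) {d : ℕ} (hAd : A ^ d = 1) :
    ∑ k ∈ Finset.range d, LinearMap.trace ℂ V (ρ g * A ^ k) ∈ charFieldAt G (orderOf g) := by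
  let W : Subrepresentation ρ :=
    { toSubmodule := LinearMap.ker (A - 1)
      apply_mem_toSubmodule := fun h v hv => by
        rw [LinearMap.mem_ker, LinearMap.sub_apply, Module.End.one_apply, sub_eq_zero] at hv ⊢
        rw [← Module.End.mul_apply, (hA h).eq, Module.End.mul_apply, hv] }
  let S : Module.End ℂ V := ∑ k ∈ Finset.range d, A ^ k
  have hS : (A - 1) * S = 0 := by rw [mul_geom_sum, hAd, sub_self]
  let π : V →ₗ[ℂ] W.toSubmodule := S.codRestrict _ fun v => by
    rw [LinearMap.mem_ker, ← Module.End.mul_apply, hS, LinearMap.zero_apply]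
  have hpow (v : W.toSubmodule) (k : ℕ) : (A ^ k) (v : V) = v := by
    have hv := v.2
    rw [LinearMap.mem_ker, LinearMap.sub_apply, Module.End.one_apply, sub_eq_zero] at hv
    induction k with
    | zero => simp
    | succ k ih => rw [pow_succ, Module.End.mul_apply, hv, ih]
  have hπ : π ∘ₗ W.toSubmodule.subtype = (d : ℂ) • LinearMap.id := by
    ext v
    simp [π, S, hpow, Nat.cast_smul_eq_nsmul]
  have key : ∑ k ∈ Finset.range d, LinearMap.trace ℂ V (ρ g * A ^ k) =
      (d : ℂ) * LinearMap.trace ℂ W.toSubmodule (W.toRepresentation g) := by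
    rw [← map_sum, ← Finset.mul_sum]
    have h1 : ρ g * S = W.toSubmodule.subtype ∘ₗ (W.toRepresentation g ∘ₗ π) := by
      ext v
      rfl
    change LinearMap.trace ℂ V (ρ g * S) = _
    rw [h1, LinearMap.trace_comp_comm', LinearMap.comp_assoc, hπ, LinearMap.comp_smul, map_smul,
      LinearMap.comp_id, smul_eq_mul]
  rw [key]
  exact mul_mem (natCast_mem _ d) (trace_mem_charFieldAt g _)

theorem LinearMap.trace_funLeft {ι : Type*} [Fintype ι] [DecidableEq ι] (s : ι → ι) :
    LinearMap.trace ℂ (ι → ℂ) (LinearMap.funLeft ℂ ℂ s) =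
      (Finset.univ.filter fun x => s x = x).card := by
  rw [LinearMap.trace_eq_matrix_trace ℂ (Pi.basisFun ℂ ι)]
  simp [Matrix.trace, LinearMap.funLeft_apply, Pi.single_apply,
    Finset.sum_boole]

/-- If a real element `g` of order `d` is conjugate to no powers of itself but `g` and `g⁻¹`,
the representation induced from a faithful character of `⟨g⟩` contributes `ζ + ζ⁻¹`. -/
theorem add_inv_mem_charFieldAt {G : Type} [Group G] [Finite G] (g : G)
    (hg : 2 < orderOf g) (hreal : IsConj g g⁻¹)
    (hconj : ∀ k : ℕ, IsConj g (g ^ k) → g ^ k = g ∨ g ^ k = g⁻¹)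
    {z : ℂ} (hz : z ^ orderOf g = 1) : z + z⁻¹ ∈ charFieldAt G (orderOf g) := by
  classical
  have := Fintype.ofFinite G
  have hd : orderOf g ≠ 0 := by omega
  have hz0 : z ≠ 0 := by
    rintro rfl
    simp [hd] at hz
  let ρ : Representation ℂ G (G → ℂ) :=
    { toFun := fun h => LinearMap.funLeft ℂ ℂ (· * h)
      map_one' := by ext; simp [LinearMap.funLeft_apply]
      map_mul' := fun a b => by ext; simp [LinearMap.funLeft_apply, mul_assoc] }
  let L : Module.End ℂ (G → ℂ) := LinearMap.funLeft ℂ ℂ (g * ·)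
  have hL (k : ℕ) : L ^ k = LinearMap.funLeft ℂ ℂ (g ^ k * ·) := by
    induction k with
    | zero => ext; simp [LinearMap.funLeft_apply]
    | succ k ih =>
      rw [pow_succ, ih]
      ext
      simp [L, LinearMap.funLeft_apply, pow_succ', mul_assoc]
  let N : ℕ → ℕ := fun k => (Finset.univ.filter fun x => g ^ k * x * g = x).card
  have hsum := sum_trace_mul_pow_mem_charFieldAt g ρ (z⁻¹ • L)
    (fun h => by
      ext f x
      simp [ρ, L, LinearMap.funLeft_apply, mul_assoc])
    (by
      rw [smul_pow, hL, inv_pow, hz, pow_orderOf_eq_one]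
      ext
      simp [LinearMap.funLeft_apply])
  have htr (k : ℕ) : LinearMap.trace ℂ (G → ℂ) (ρ g * (z⁻¹ • L) ^ k) = z⁻¹ ^ k * N k := by
    have : ρ g * (z⁻¹ • L) ^ k = z⁻¹ ^ k • LinearMap.funLeft ℂ ℂ (fun x => g ^ k * x * g) := by
      rw [smul_pow, hL]
      ext
      simp [ρ, LinearMap.funLeft_apply, mul_assoc]
    rw [this, map_smul, LinearMap.trace_funLeft, smul_eq_mul]
  simp only [htr] at hsum
  have hlast : g ^ (orderOf g - 1) = g⁻¹ := by
    rw [eq_inv_iff_mul_eq_one, ← pow_succ, Nat.sub_add_cancel (by omega), pow_orderOf_eq_one]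
  have hN0 (k : ℕ) (hk : k < orderOf g) (h1 : k ≠ 1) (h2 : k ≠ orderOf g - 1) : N k = 0 := by
    rw [Finset.card_eq_zero, Finset.filter_eq_empty_iff]
    intro x _ hx
    have hc : IsConj g (g ^ (orderOf g - k)) := by
      rw [isConj_iff]
      refine ⟨x, ?_⟩
      have : g ^ (orderOf g - k) = (g ^ k)⁻¹ := by
        rw [eq_inv_iff_mul_eq_one, ← pow_add, Nat.sub_add_cancel hk.le, pow_orderOf_eq_one]
      rw [this, mul_inv_eq_iff_eq_mul, eq_inv_mul_iff_mul_eq, ← mul_assoc, hx]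
    have hinj {a b : ℕ} (ha : a ≤ orderOf g) (hb : b < orderOf g) (hb0 : 0 < b)
        (h : g ^ a = g ^ b) : a = b := by
      rcases ha.lt_or_eq with ha | rfl
      · exact pow_injOn_Iio_orderOf ha hb h
      · exact absurd (orderOf_dvd_of_pow_eq_one (h.symm.trans (pow_orderOf_eq_one g)))
          (Nat.not_dvd_of_pos_of_lt hb0 hb)
    rcases hconj _ hc with h | h
    · have := hinj (Nat.sub_le _ _) (by omega) one_pos (h.trans (pow_one g).symm)
      omega
    · have := hinj (Nat.sub_le _ _) (by omega) (by omega) (h.trans hlast.symm)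
      omega
  obtain ⟨y, hy⟩ := isConj_iff.mp hreal
  have hN1 : N (orderOf g - 1) = N 1 := by
    refine (Finset.card_equiv (Equiv.mulLeft y) fun x => ?_).symm
    have hy' : y * g = g⁻¹ * y := by rw [← hy]; group
    simp only [Finset.mem_filter, Finset.mem_univ, true_and, Equiv.coe_mulLeft, hlast, pow_one]
    rw [← mul_assoc, ← hy', mul_assoc y, mul_assoc y, mul_right_inj]
  have hNpos : (N 1 : ℂ) ≠ 0 := by
    rw [← hN1, Nat.cast_ne_zero, Finset.card_ne_zero]
    exact ⟨1, by simp [hlast]⟩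
  have hzlast : z⁻¹ ^ (orderOf g - 1) = z := by
    rw [inv_pow]
    refine inv_eq_of_mul_eq_one_right ?_
    rw [← pow_succ, Nat.sub_add_cancel (by omega), hz]
  rw [← Finset.sum_subset (s₁ := {orderOf g - 1, 1}) (by intro k; simp; omega)
    (fun k hk hk' => by
      simp only [Finset.mem_insert, Finset.mem_singleton, not_or] at hk'
      rw [hN0 k (Finset.mem_range.mp hk) hk'.2 hk'.1, Nat.cast_zero, mul_zero]),
    Finset.sum_pair (by omega), hN1, hzlast, pow_one, ← add_mul] at hsum
  have := div_mem hsum (natCast_mem (charFieldAt G (orderOf g)) (N 1))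
  rwa [mul_div_cancel_right₀ _ hNpos] at this

theorem LinearMap.trace_aeval_mem {V : Type*} [AddCommGroup V] [Module ℂ V]
    [FiniteDimensional ℂ V] (E : IntermediateField ℚ ℂ) (f : Module.End ℂ V) {d : ℕ}
    (hf : f ^ d = 1) (Q : Polynomial ℂ) (hQ : ∀ μ : ℂ, μ ^ d = 1 → Q.eval μ ∈ E) :
    LinearMap.trace ℂ V (Polynomial.aeval f Q) ∈ E := by
  rw [Module.End.trace_eq_sum_roots_charpoly_of_splits (IsAlgClosed.splits _)]
  refine multiset_sum_mem _ fun c hc => ?_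
  have hev : Module.End.HasEigenvalue (Polynomial.aeval f Q) c := by
    rw [Module.End.hasEigenvalue_iff_isRoot_charpoly]
    exact Polynomial.isRoot_of_mem_roots hc
  obtain ⟨v, hv⟩ := hev.exists_hasEigenvector
  have : Nontrivial V := ⟨v, 0, hv.2⟩
  have hspec := Module.End.hasEigenvalue_iff_mem_spectrum.mp hev
  rw [spectrum.map_polynomial_aeval_of_nonempty _ _
    (spectrum.nonempty_of_isAlgClosed_of_finiteDimensional ℂ f)] at hspec
  obtain ⟨μ, hμ, rfl⟩ := hspec
  refine hQ μ ?_
  obtain ⟨w, hw⟩ := (Module.End.hasEigenvalue_iff_mem_spectrum.mpr hμ).exists_hasEigenvector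
  have := hw.pow_apply d
  rw [hf, Module.End.one_apply] at this
  have h2 : (μ ^ d - 1) • w = 0 := by rw [sub_smul, one_smul, ← this, sub_self]
  exact sub_eq_zero.mp ((smul_eq_zero.mp h2).resolve_right hw.2)

section GL2

open Matrix Polynomial

variable {F : Type} [Field F]

theorem Matrix.sq_fin_two (M : Matrix (Fin 2) (Fin 2) F) :
    M ^ 2 = M.trace • M - M.det • (1 : Matrix (Fin 2) (Fin 2) F) := by
  ext i j
  fin_cases i <;> fin_cases j <;>
    simp [pow_two, Matrix.mul_apply, Fin.sum_univ_two, Matrix.trace, Matrix.det_fin_two] <;> ring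

theorem Matrix.exists_mul_eq_mul_companion (M : Matrix (Fin 2) (Fin 2) F)
    (hM : ∀ c : F, M ≠ c • (1 : Matrix (Fin 2) (Fin 2) F)) :
    ∃ P : GL (Fin 2) F, M * P.1 = P.1 * !![0, -M.det; 1, M.trace] := by
  obtain ⟨x, y, hxy⟩ : ∃ x y : F,
      (!![x, M 0 0 * x + M 0 1 * y; y, M 1 0 * x + M 1 1 * y]).det ≠ 0 := by
    simp only [Matrix.det_fin_two_of]
    by_contra! h
    have h1 := h 1 0
    have h2 := h 0 1
    have h3 := h 1 1
    apply hM (M 0 0)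
    ext i j
    fin_cases i <;> fin_cases j <;> simp at * <;> grind
  refine ⟨Matrix.GeneralLinearGroup.mkOfDetNeZero _ hxy, ?_⟩
  ext i j
  fin_cases i <;> fin_cases j <;>
    simp [Matrix.GeneralLinearGroup.mkOfDetNeZero, Matrix.mul_apply, Fin.sum_univ_two,
      Matrix.trace, Matrix.det_fin_two] <;> ring

theorem Matrix.GeneralLinearGroup.isConj_of_trace_eq_of_det_eq {g h : GL (Fin 2) F}
    (hg : ∀ c : F, g.1 ≠ c • (1 : Matrix (Fin 2) (Fin 2) F))
    (hh : ∀ c : F, h.1 ≠ c • (1 : Matrix (Fin 2) (Fin 2) F))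
    (htr : g.1.trace = h.1.trace) (hdet : g.1.det = h.1.det) : IsConj g h := by
  obtain ⟨P, hP⟩ := Matrix.exists_mul_eq_mul_companion g.1 hg
  obtain ⟨Q, hQ⟩ := Matrix.exists_mul_eq_mul_companion h.1 hh
  rw [← htr, ← hdet] at hQ
  set C : Matrix (Fin 2) (Fin 2) F := !![0, -g.1.det; 1, g.1.trace]
  have hP' : C = (P⁻¹ * g * P : GL (Fin 2) F).1 := by
    simp only [Units.val_mul, mul_assoc, hP]
    rw [← mul_assoc, Units.inv_mul, one_mul]
  have hQ' : C = (Q⁻¹ * h * Q : GL (Fin 2) F).1 := by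
    simp only [Units.val_mul, mul_assoc, hQ]
    rw [← mul_assoc, Units.inv_mul, one_mul]
  have h1 : P⁻¹ * g * P = Q⁻¹ * h * Q := Units.ext (hP'.symm.trans hQ')
  refine isConj_iff.mpr ⟨Q * P⁻¹, ?_⟩
  calc Q * P⁻¹ * g * (Q * P⁻¹)⁻¹ = Q * (P⁻¹ * g * P) * Q⁻¹ := by group
    _ = h := by rw [h1]; group

theorem Matrix.GeneralLinearGroup.ne_smul_one_of_sq_ne_one {g : GL (Fin 2) F}
    (hdet : g.1.det = 1) (hg : g ^ 2 ≠ 1) (c : F) :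
    g.1 ≠ c • (1 : Matrix (Fin 2) (Fin 2) F) := by
  intro h
  apply hg
  have hc : c ^ 2 = 1 := by
    rw [h, Matrix.det_smul, Matrix.det_one, Fintype.card_fin, mul_one] at hdet
    exact hdet
  ext1
  rw [Units.val_pow_eq_pow_val, h, _root_.smul_pow, hc, one_pow, one_smul, Units.val_one]

theorem Matrix.GeneralLinearGroup.coe_inv_of_det_eq_one {g : GL (Fin 2) F} (hdet : g.1.det = 1) :
    (g⁻¹).1 = g.1.trace • (1 : Matrix (Fin 2) (Fin 2) F) - g.1 := by
  have h := Matrix.sq_fin_two g.1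
  rw [hdet, one_smul] at h
  have h1 : g.1 * (g.1.trace • (1 : Matrix (Fin 2) (Fin 2) F) - g.1) = 1 := by
    rw [mul_sub, ← pow_two, h, mul_smul_comm, mul_one]
    abel
  calc (g⁻¹).1 = (g⁻¹).1 * (g.1 * (g.1.trace • (1 : Matrix (Fin 2) (Fin 2) F) - g.1)) := by
        rw [h1, mul_one]
    _ = _ := by rw [← mul_assoc, Units.inv_mul, one_mul]

theorem Matrix.GeneralLinearGroup.isConj_inv_of_det_eq_one {g : GL (Fin 2) F}
    (hdet : g.1.det = 1) (hg : g ^ 2 ≠ 1) : IsConj g g⁻¹ := by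
  have hdet' : (g⁻¹).1.det = 1 := by
    have : g.1.det * (g⁻¹).1.det = 1 := by
      rw [← Matrix.det_mul, Units.mul_inv, Matrix.det_one]
    rwa [hdet, one_mul] at this
  refine isConj_of_trace_eq_of_det_eq (ne_smul_one_of_sq_ne_one hdet hg)
    (ne_smul_one_of_sq_ne_one hdet' (by rwa [inv_pow, Ne, inv_eq_one])) ?_ (hdet.trans hdet'.symm)
  rw [coe_inv_of_det_eq_one hdet, Matrix.trace_sub, Matrix.trace_smul, Matrix.trace_one]
  simp
  ring

theorem Matrix.GeneralLinearGroup.eq_one_of_det_sub_one {p m : ℕ} [Fact p.Prime] [CharP F p]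
    (hm : m.Coprime p) {u : GL (Fin 2) F} (hu : u ^ m = 1) (hdet : u.1.det = 1)
    (h1 : (u.1 - 1).det = 0) : u = 1 := by
  have htr : u.1.trace = 2 := by
    rw [Matrix.det_fin_two] at h1 hdet
    simp [Matrix.trace, Fin.sum_univ_two] at h1 ⊢
    linear_combination hdet - h1
  have hsq : (u.1 - 1) ^ 2 = 0 := by
    have h := Matrix.sq_fin_two u.1
    rw [htr, hdet, one_smul, two_smul] at h
    rw [(Commute.one_right u.1).sub_sq, h]
    simp only [mul_one, one_pow, two_mul]
    abel
  have hp : (u.1 - 1) ^ p = 0 :=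
    pow_eq_zero_of_le (Fact.out : p.Prime).two_le hsq
  rw [sub_pow_char_of_commute _ (Commute.one_right _), one_pow, sub_eq_zero] at hp
  have hup : u ^ p = 1 := Units.ext (by rw [Units.val_pow_eq_pow_val, hp, Units.val_one])
  have h := Nat.dvd_gcd (orderOf_dvd_of_pow_eq_one hu) (orderOf_dvd_of_pow_eq_one hup)
  rw [hm, Nat.dvd_one, orderOf_eq_one_iff] at h
  exact h

theorem Matrix.GeneralLinearGroup.pow_eq_or_eq_inv_of_isConj {p : ℕ} [Fact p.Prime] [CharP F p]
    {g : GL (Fin 2) F} (hm : (orderOf g).Coprime p) (hdet : g.1.det = 1) (k : ℕ)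
    (hk : IsConj g (g ^ k)) : g ^ k = g ∨ g ^ k = g⁻¹ := by
  obtain ⟨y, hy⟩ := isConj_iff.mp hk
  have htr : (g ^ k).1.trace = g.1.trace := by
    rw [← hy, Units.val_mul, Matrix.trace_mul_comm, ← Units.val_mul]
    congr 2
    group
  have hdetk : (g ^ k).1.det = 1 := by
    rw [Units.val_pow_eq_pow_val, Matrix.det_pow, hdet, one_pow]
  have hdeti : (g⁻¹).1.det = 1 := by
    have : g.1.det * (g⁻¹).1.det = 1 := by
      rw [← Matrix.det_mul, Units.mul_inv, Matrix.det_one]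
    rwa [hdet, one_mul] at this
  have hprod : ((g ^ k).1 - g.1) * ((g ^ k).1 - (g⁻¹).1) = 0 := by
    have h1 := Matrix.sq_fin_two (g ^ k).1
    rw [htr, hdetk, one_smul] at h1
    have h2 := coe_inv_of_det_eq_one hdet
    have h3 : (g ^ k).1 * (g⁻¹).1 = g.1.trace • (g ^ k).1 - g.1 * (g ^ k).1 := by
      rw [← Units.val_mul, ((Commute.refl g).inv_right.pow_left k).eq, Units.val_mul, h2, sub_mul,
        smul_mul_assoc, one_mul]
    rw [sub_mul, mul_sub, mul_sub, ← pow_two, h1, h3, Units.mul_inv]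
    abel
  have hd := congrArg Matrix.det hprod
  rw [Matrix.det_mul, Matrix.det_zero, mul_eq_zero] at hd
  rcases hd with hd | hd
  · left
    have : g ^ k * g⁻¹ = 1 := by
      refine eq_one_of_det_sub_one hm ?_ ?_ ?_
      · rw [((Commute.refl g).inv_right.pow_left k).mul_pow, ← pow_mul, mul_comm k, pow_mul,
          inv_pow, pow_orderOf_eq_one, one_pow, inv_one, one_mul]
      · rw [Units.val_mul, Matrix.det_mul, hdetk, hdeti, one_mul]
      · have : (g ^ k * g⁻¹).1 - 1 = ((g ^ k).1 - g.1) * (g⁻¹).1 := by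
          rw [sub_mul, Units.mul_inv, Units.val_mul]
        rw [this, Matrix.det_mul, hd, zero_mul]
    exact mul_inv_eq_one.mp this
  · right
    have : g ^ k * g = 1 := by
      refine eq_one_of_det_sub_one hm ?_ ?_ ?_
      · rw [← pow_succ, ← pow_mul, mul_comm, pow_mul, pow_orderOf_eq_one, one_pow]
      · rw [Units.val_mul, Matrix.det_mul, hdetk, hdet, one_mul]
      · have : (g ^ k * g).1 - 1 = ((g ^ k).1 - (g⁻¹).1) * g.1 := by
          rw [sub_mul, Units.inv_mul, Units.val_mul]
        rw [this, Matrix.det_mul, hd, zero_mul]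
    exact eq_inv_of_mul_eq_one_left this

/-- An element `g` of `GL₂(F_q)` with `g ^ q = g⁻¹ ≠ g` has norm one. -/
theorem Matrix.GeneralLinearGroup.det_eq_one_of_pow_card_add_one [Fintype F] {g : GL (Fin 2) F}
    (hg : g ^ (Fintype.card F + 1) = 1) (hg2 : g ^ 2 ≠ 1) : g.1.det = 1 := by
  have hq : g.1 ^ Fintype.card F = (g⁻¹).1 := by
    rw [← Units.val_pow_eq_pow_val,
      eq_inv_of_mul_eq_one_left (a := g ^ Fintype.card F) (by rwa [← pow_succ])]
  have h1 : Polynomial.aeval ((g⁻¹).1) g.1.charpoly = 0 := by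
    rw [← hq, ← Polynomial.expand_aeval, FiniteField.expand_card, map_pow,
      Matrix.aeval_self_charpoly, zero_pow Fintype.card_ne_zero]
  rw [Matrix.charpoly_fin_two] at h1
  simp only [map_add, map_sub, map_mul, map_pow, Polynomial.aeval_X, Polynomial.aeval_C,
    Algebra.algebraMap_eq_smul_one, smul_mul_assoc, one_mul] at h1
  have h2 := congrArg (· * g.1 ^ 2) h1
  have e1 : (g⁻¹).1 ^ 2 * g.1 ^ 2 = 1 := by
    rw [← Units.val_pow_eq_pow_val, ← Units.val_pow_eq_pow_val, ← Units.val_mul]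
    simp
  have e2 : (g⁻¹).1 * g.1 ^ 2 = g.1 := by
    rw [pow_two, ← mul_assoc, Units.inv_mul, one_mul]
  simp only [add_mul, sub_mul, smul_mul_assoc, one_mul, zero_mul, e1, e2] at h2
  have h3 := Matrix.sq_fin_two g.1
  have h4 : (g.1.det - 1) • (g.1 ^ 2 - 1) = 0 := by
    rw [sub_smul, one_smul, smul_sub]
    have : g.1.trace • g.1 = g.1 ^ 2 + g.1.det • (1 : Matrix (Fin 2) (Fin 2) F) := by
      rw [h3]; abel
    rw [this] at h2
    rw [← h2]
    abel
  rcases smul_eq_zero.mp h4 with h | h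
  · exact sub_eq_zero.mp h
  · exact absurd (Units.ext (by rwa [Units.val_pow_eq_pow_val, Units.val_one, ← sub_eq_zero])) hg2

end GL2

theorem zeta_isPrimitiveRoot {N : ℕ} (hN : N ≠ 0) : IsPrimitiveRoot (zeta N) N :=
  Complex.isPrimitiveRoot_exp N hN

theorem charFieldAt_le_adjoin_zeta (G : Type) [Group G] {d : ℕ} (hd : d ≠ 0) :
    charFieldAt G d ≤ IntermediateField.adjoin ℚ {zeta d} := by
  have := NeZero.mk hd
  refine IntermediateField.adjoin_le_iff.mpr ?_
  rintro _ ⟨V, -, g, hg, rfl⟩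
  have h := LinearMap.trace_aeval_mem (IntermediateField.adjoin ℚ {zeta d}) (V.ρ g) (d := d)
    (by rw [← map_pow, ← hg, pow_orderOf_eq_one, map_one]) Polynomial.X fun μ hμ => by
      obtain ⟨i, -, rfl⟩ := (zeta_isPrimitiveRoot hd).eq_pow_of_pow_eq_one hμ
      rw [Polynomial.eval_X]
      exact pow_mem (IntermediateField.mem_adjoin_simple_self ℚ _) i
  rwa [Polynomial.aeval_X] at h

theorem IntermediateField.pow_add_inv_pow_mem (E : IntermediateField ℚ ℂ) {z : ℂ} (hz : z ≠ 0)
    (h : z + z⁻¹ ∈ E) (i : ℕ) : z ^ i + (z ^ i)⁻¹ ∈ E := by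
  induction i using Nat.twoStepInduction with
  | zero => simpa using add_mem (one_mem E) (one_mem E)
  | one => simpa using h
  | more i h0 h1 =>
    have : z ^ (i + 2) + (z ^ (i + 2))⁻¹ =
        (z + z⁻¹) * (z ^ (i + 1) + (z ^ (i + 1))⁻¹) - (z ^ i + (z ^ i)⁻¹) := by
      field_simp
      ring
    rw [this]
    exact sub_mem (mul_mem h h1) h0

theorem charFieldAt_le_adjoin_zeta_add_inv (G : Type) [Group G] {d : ℕ} (hd : d ≠ 0)
    (hreal : ∀ g : G, orderOf g = d → IsConj g g⁻¹) :
    charFieldAt G d ≤ IntermediateField.adjoin ℚ {zeta d + (zeta d)⁻¹} := by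
  have := NeZero.mk hd
  set E := IntermediateField.adjoin ℚ {zeta d + (zeta d)⁻¹} with hE
  refine IntermediateField.adjoin_le_iff.mpr ?_
  rintro _ ⟨V, -, g, hg, rfl⟩
  have hgd : g ^ d = 1 := by rw [← hg, pow_orderOf_eq_one]
  have h := LinearMap.trace_aeval_mem E (V.ρ g) (d := d)
    (by rw [← map_pow, hgd, map_one]) (Polynomial.X + Polynomial.X ^ (d - 1)) fun μ hμ => by
      obtain ⟨i, -, rfl⟩ := (zeta_isPrimitiveRoot hd).eq_pow_of_pow_eq_one hμ
      have hinv : (zeta d ^ i) ^ (d - 1) = (zeta d ^ i)⁻¹ := by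
        refine eq_inv_of_mul_eq_one_left ?_
        rw [← pow_succ, Nat.sub_add_cancel (Nat.one_le_iff_ne_zero.mpr hd), hμ]
      rw [Polynomial.eval_add, Polynomial.eval_pow, Polynomial.eval_X, hinv]
      exact E.pow_add_inv_pow_mem ((zeta_isPrimitiveRoot hd).ne_zero hd)
        (IntermediateField.mem_adjoin_simple_self ℚ _) i
  have hginv : g ^ (d - 1) = g⁻¹ := by
    refine eq_inv_of_mul_eq_one_left ?_
    rw [← pow_succ, Nat.sub_add_cancel (Nat.one_le_iff_ne_zero.mpr hd), hgd]
  obtain ⟨y, hy⟩ := isConj_iff.mp (hreal g hg)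
  rw [map_add, map_pow, Polynomial.aeval_X, ← map_pow, hginv, map_add] at h
  change V.character g + V.character g⁻¹ ∈ E at h
  rw [← hy, FDRep.char_conj, ← two_mul] at h
  have := div_mem h (ofNat_mem E 2)
  rwa [mul_div_cancel_left₀ _ two_ne_zero] at this

theorem zeta_mem_charFieldAt_GL {F : Type} [Field F] [Fintype F] {d : ℕ}
    (hd : d ∣ Fintype.card F - 1) : zeta d ∈ charFieldAt (GL (Fin 2) F) d := by
  classical
  have hcard : Nat.card Fˣ = Fintype.card F - 1 := by
    rw [Nat.card_eq_fintype_card, Fintype.card_units]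
  have hN : Fintype.card F - 1 ≠ 0 := by
    have := Fintype.one_lt_card (α := F)
    omega
  have := NeZero.mk hN
  have hd0 : d ≠ 0 := ne_zero_of_dvd_ne_zero hN hd
  have := NeZero.mk hd0
  obtain ⟨u, hu⟩ := IsCyclic.exists_generator (α := Fˣ)
  have huo : orderOf u = Fintype.card F - 1 := by
    rw [orderOf_eq_card_of_forall_mem_zpowers hu, hcard]
  let a : Fˣ := u ^ ((Fintype.card F - 1) / d)
  have ha : orderOf a = d := by
    rw [orderOf_pow_of_dvd (Nat.div_pos (Nat.le_of_dvd (Nat.pos_of_ne_zero hN) hd)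
      (Nat.pos_of_ne_zero hd0)).ne' (huo.symm ▸ Nat.div_dvd_of_dvd hd), huo, Nat.div_div_self hd hN]
  let e : Fˣ ≃* rootsOfUnity (Fintype.card F - 1) ℂ :=
    mulEquivOfCyclicCardEq (by
      rw [hcard, Complex.card_rootsOfUnity])
  let χ : Fˣ →* ℂˣ := (rootsOfUnity (Fintype.card F - 1) ℂ).subtype.comp e.toMonoidHom
  have hχ : Function.Injective χ := Subtype.val_injective.comp e.injective
  let ρ : Representation ℂ (GL (Fin 2) F) ℂ :=
    ((Algebra.lmul ℂ ℂ).toMonoidHom.comp (Units.coeHom ℂ)).comp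
      (χ.comp Matrix.GeneralLinearGroup.det)
  let D : Fˣ →* GL (Fin 2) F :=
    (Units.map (Matrix.diagonalRingHom (Fin 2) F).toMonoidHom).comp
      (MulEquiv.piUnits.symm.toMonoidHom.comp (MonoidHom.mulSingle (fun _ : Fin 2 => Fˣ) 0))
  have hdet (x : Fˣ) : Matrix.GeneralLinearGroup.det (D x) = x := by
    ext
    simp [D]
  have hD : Function.Injective D := Function.LeftInverse.injective hdet
  have htr : LinearMap.trace ℂ ℂ (ρ (D a)) = χ a := by
    have : ρ (D a) = ((χ a : ℂˣ) : ℂ) • LinearMap.id := by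
      ext
      simp [ρ, hdet]
    rw [this, map_smul, LinearMap.trace_id, Module.finrank_self]
    simp
  have hmem := trace_mem_charFieldAt (D a) ρ
  rw [htr, orderOf_injective D hD, ha] at hmem
  have hprim : IsPrimitiveRoot ((χ a : ℂˣ) : ℂ) d := by
    rw [← ha, ← orderOf_injective χ hχ, ← orderOf_units]
    exact IsPrimitiveRoot.orderOf _
  obtain ⟨i, -, hi⟩ := hprim.eq_pow_of_pow_eq_one (zeta_isPrimitiveRoot hd0).pow_eq_one
  rw [← hi]
  exact pow_mem hmem i

theorem charFieldAt_GL_eq_of_dvd_card_sub_one {F : Type} [Field F] [Fintype F] {d : ℕ}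
    (hd : d ∣ Fintype.card F - 1) :
    charFieldAt (GL (Fin 2) F) d = IntermediateField.adjoin ℚ {zeta d} := by
  have hd0 : d ≠ 0 := by
    have := Fintype.one_lt_card (α := F)
    exact ne_zero_of_dvd_ne_zero (by omega) hd
  exact le_antisymm (charFieldAt_le_adjoin_zeta _ hd0)
    (IntermediateField.adjoin_simple_le_iff.mpr (zeta_mem_charFieldAt_GL hd))

theorem charFieldAt_GL_eq_of_dvd_card_add_one {F : Type} [Field F] [Fintype F] {p d : ℕ}
    [Fact p.Prime] [CharP F p] (hd : d ∣ Fintype.card F + 1) (hd2 : 2 < d) (hdp : d.Coprime p)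
    (hex : ∃ g : GL (Fin 2) F, orderOf g = d) :
    charFieldAt (GL (Fin 2) F) d = IntermediateField.adjoin ℚ {zeta d + (zeta d)⁻¹} := by
  have hsq (g : GL (Fin 2) F) (hg : orderOf g = d) : g ^ 2 ≠ 1 := fun h => by
    have := Nat.le_of_dvd two_pos (orderOf_dvd_of_pow_eq_one h)
    omega
  have hdet (g : GL (Fin 2) F) (hg : orderOf g = d) : g.1.det = 1 :=
    Matrix.GeneralLinearGroup.det_eq_one_of_pow_card_add_one
      (orderOf_dvd_iff_pow_eq_one.mp (hg ▸ hd)) (hsq g hg)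
  have hreal (g : GL (Fin 2) F) (hg : orderOf g = d) : IsConj g g⁻¹ :=
    Matrix.GeneralLinearGroup.isConj_inv_of_det_eq_one (hdet g hg) (hsq g hg)
  refine le_antisymm (charFieldAt_le_adjoin_zeta_add_inv _ (by omega) hreal)
    (IntermediateField.adjoin_simple_le_iff.mpr ?_)
  obtain ⟨g, rfl⟩ := hex
  exact add_inv_mem_charFieldAt g hd2 (hreal g rfl)
    (Matrix.GeneralLinearGroup.pow_eq_or_eq_inv_of_isConj hdp (hdet g rfl))
    (zeta_isPrimitiveRoot (by omega)).pow_eq_one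

/-- For `p` odd and `GL_2(F_q)` containing an element of order `2^r`,
`K_{2^r}(GL_2(F_q)) = ℚ(ζ_{2^r})` if `q ≡ 1 (mod 2^r)`, and
`K_{2^r}(GL_2(F_q)) = ℚ(ζ_{2^r} + ζ_{2^r}^{−1})` if `q ≡ −1 (mod 2^r)`. -/
theorem statement17 (p n q r : ℕ) (hp : p.Prime) (hodd : Odd p) (hn : 1 ≤ n)
    (hq : q = p ^ n) (hr : 1 ≤ r)
    (F : Type) [Field F] [Fintype F] (hF : Fintype.card F = q)
    (hex : ∃ g : GL (Fin 2) F, orderOf g = 2 ^ r) :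
    ((q : ZMod (2 ^ r)) = 1 →
      charFieldAt (GL (Fin 2) F) (2 ^ r) = IntermediateField.adjoin ℚ {zeta (2 ^ r)}) ∧
    ((q : ZMod (2 ^ r)) = -1 →
      charFieldAt (GL (Fin 2) F) (2 ^ r) =
        IntermediateField.adjoin ℚ {zeta (2 ^ r) + (zeta (2 ^ r))⁻¹}) := by
  have := Fact.mk hp
  have : CharP F p := charP_of_card_eq_prime_pow (hF.trans hq)
  have hq1 : 1 ≤ q := hq ▸ Nat.one_le_pow _ _ hp.pos
  have hone : (q : ZMod (2 ^ r)) = 1 →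
      charFieldAt (GL (Fin 2) F) (2 ^ r) = IntermediateField.adjoin ℚ {zeta (2 ^ r)} := by
    intro h
    refine charFieldAt_GL_eq_of_dvd_card_sub_one ?_
    rw [hF, ← ZMod.natCast_eq_zero_iff, Nat.cast_sub hq1, h, Nat.cast_one, sub_self]
  refine ⟨hone, fun h => ?_⟩
  rcases hr.eq_or_lt with rfl | hr2
  · have hz : zeta (2 ^ 1) = -1 := (zeta_isPrimitiveRoot two_ne_zero).eq_neg_one_of_two_right
    rw [hone (by rw [h]; decide), hz, inv_neg, inv_one,
      IntermediateField.adjoin_simple_eq_bot_iff.mpr (neg_mem (one_mem _)),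
      IntermediateField.adjoin_simple_eq_bot_iff.mpr
        (add_mem (neg_mem (one_mem _)) (neg_mem (one_mem _)))]
  · refine charFieldAt_GL_eq_of_dvd_card_add_one (p := p) ?_ ?_ ?_ hex
    · rw [hF, ← ZMod.natCast_eq_zero_iff, Nat.cast_add, h, Nat.cast_one, neg_add_cancel]
    · calc 2 < 2 ^ 2 := by norm_num
        _ ≤ 2 ^ r := Nat.pow_le_pow_right two_pos hr2
    · exact (Nat.coprime_two_left.mpr hodd).pow_left r
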